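/- For every s > 1, the function x ↦ Ω_s(x) is differentiable on ℝ \ {0}, and Ω_s(x) has a finite limit as x → 0 (x ≠ 0), i.e., Ω_s extends to a function continuous at 0. -/

import Mathlib

open Complex Filter Finset

noncomputable section

/-- `ρ = e^{iπ/4}`. -/
def ρ : ℂ := Complex.exp (Real.pi * Complex.I / 4)

/-- Partial sum `F_{s,n}(x,t) = Σ_{k=1}^{n} e^{iπk²x + 2πikt}/k^s`. -/
def Fpart (s : ℝ) (n : ℕ) (x t : ℝ) : ℂ :=
  ∑ k ∈ Finset.Icc 1 n,
    Complex.exp (Real.pi * Complex.I * (k : ℂ) ^ 2 * (x : ℂ)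
        + 2 * Real.pi * Complex.I * (k : ℂ) * (t : ℂ)) / (k : ℂ) ^ (s : ℂ)

/-- The function `I_s(x,t)` (for `x > 0`). -/
def Ifun (s x t : ℝ) : ℂ :=
  (∫ u : ℝ, ρ *
      (Complex.exp (Real.pi * Complex.I * ((1 : ℂ) / 2 + ρ * (u : ℂ)) ^ 2 * (x : ℂ)
            + 2 * Real.pi * Complex.I * ((1 : ℂ) / 2 + ρ * (u : ℂ)) * (Int.fract t : ℝ)) /
        (((1 : ℂ) / 2 + ρ * (u : ℂ)) ^ (s : ℂ) *
          (1 - Complex.exp (2 * Real.pi * Complex.I * ((1 : ℂ) / 2 + ρ * (u : ℂ)))))))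
  + ρ * (x : ℂ) ^ (s : ℂ) *
    ∫ u : ℝ, (Real.exp (-(Real.pi * x * u ^ 2)) : ℝ) *
      ∑' k : ℕ, Complex.exp (-(Real.pi * Complex.I * (((k : ℂ) + 1) - (Int.fract t : ℝ)) ^ 2 / (x : ℂ))) *
        (((ρ * (x : ℂ) * (u : ℂ) + ((k : ℂ) + 1) - (Int.fract t : ℝ)) ^ (s : ℂ))⁻¹
          - (((k : ℂ) + 1) ^ (s : ℂ))⁻¹)

/-- `Ω_s(x,t)`. -/
def Omega (s x t : ℝ) : ℂ :=
  if 0 < x then Ifun s x t else (starRingEnd ℂ) (Ifun s (-x) (-t))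

/-- `Ω_s(x) = Ω_s(x,0)`. -/
def Omega0 (s x : ℝ) : ℂ := Omega s x 0

/-- The map `T(x) = -1/x mod 2`, valued in `(-1,1]`. -/
def Tmap (x : ℝ) : ℝ := -1 / x - 2 * ⌈((-1 / x) - 1) / 2⌉

/-- Denominator `Q_n` of the `n`-th convergent of the regular continued fraction of `x`. -/
def Qden (x : ℝ) (n : ℕ) : ℝ := (GenContFract.of x).dens n

end

open scoped Topology

open MeasureTheory

/-- The point with parameter `v` on the line through `1/2` with direction `a + i`. -/
noncomputable def linePoint (a v : ℝ) : ℂ := 1 / 2 + ((a : ℂ) + Complex.I) * (v : ℂ)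

/-- The kernel `1 / (z^s (1 - e^{2πiz}))`. -/
noncomputable def kernel (s : ℝ) (z : ℂ) : ℂ :=
  (z ^ (s : ℂ) * (1 - Complex.exp (2 * Real.pi * Complex.I * z)))⁻¹

theorem linePoint_re (a v : ℝ) : (linePoint a v).re = 1 / 2 + a * v := by
  simp [linePoint]

theorem linePoint_im (a v : ℝ) : (linePoint a v).im = v := by
  simp [linePoint]

theorem linePoint_mem_slitPlane (a v : ℝ) : linePoint a v ∈ Complex.slitPlane := by
  rw [Complex.mem_slitPlane_iff, linePoint_re, linePoint_im]
  by_cases hv : v = 0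
  · left; simp [hv]
  · right; exact hv

theorem linePoint_ne_zero (a v : ℝ) : linePoint a v ≠ 0 :=
  Complex.slitPlane_ne_zero (linePoint_mem_slitPlane a v)

theorem le_norm_linePoint {a : ℝ} (ha : |a| ≤ 1) (v : ℝ) : (1 + |v|) / 6 ≤ ‖linePoint a v‖ := by
  have h1 := Complex.abs_im_le_norm (linePoint a v)
  have h2 := Complex.abs_re_le_norm (linePoint a v)
  rw [linePoint_im] at h1
  rw [linePoint_re] at h2
  have h3 : |a * v| ≤ |v| := by
    rw [abs_mul]
    exact mul_le_of_le_one_left (abs_nonneg v) ha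
  have h4 := le_abs_self (1 / 2 + a * v)
  have h5 := neg_abs_le (a * v)
  linarith

theorem exp_linePoint (a v : ℝ) :
    Complex.exp (2 * Real.pi * Complex.I * linePoint a v) =
      -((Real.exp (-(2 * Real.pi * v)) : ℝ) * Complex.exp ((2 * Real.pi * a * v : ℝ) * Complex.I)) := by
  rw [Complex.ofReal_exp, ← Complex.exp_add, ← mul_neg_one, ← Complex.exp_pi_mul_I,
    ← Complex.exp_add]
  congr 1
  rw [linePoint]
  push_cast
  linear_combination (2 * Real.pi * v : ℂ) * Complex.I_sq

theorem half_le_norm_one_sub_exp {a : ℝ} (ha : |a| ≤ 1) (v : ℝ) :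
    1 / 2 ≤ ‖1 - Complex.exp (2 * Real.pi * Complex.I * linePoint a v)‖ := by
  rw [exp_linePoint, sub_neg_eq_add]
  have hpi := Real.pi_gt_three
  have hn : ‖((Real.exp (-(2 * Real.pi * v)) : ℝ) : ℂ) *
      Complex.exp ((2 * Real.pi * a * v : ℝ) * Complex.I)‖ = Real.exp (-(2 * Real.pi * v)) := by
    rw [norm_mul, Complex.norm_exp_ofReal_mul_I, mul_one, Complex.norm_real, Real.norm_eq_abs,
      abs_of_pos (Real.exp_pos _)]
  have h2 : (2 : ℝ) ≤ Real.exp (Real.pi / 2) := by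
    have := Real.add_one_le_exp (Real.pi / 2)
    linarith
  rcases lt_or_ge |v| (1 / 4) with hv | hv
  · have hre := Complex.abs_re_le_norm (1 + ((Real.exp (-(2 * Real.pi * v)) : ℝ) : ℂ) *
      Complex.exp ((2 * Real.pi * a * v : ℝ) * Complex.I))
    rw [Complex.add_re, Complex.one_re, Complex.re_ofReal_mul, Complex.exp_ofReal_mul_I_re] at hre
    have habs : |2 * Real.pi * a * v| ≤ Real.pi / 2 := by
      rw [abs_mul, abs_mul, abs_of_pos (by positivity : 0 < 2 * Real.pi)]
      have : |a| * |v| ≤ 1 * (1 / 4) := mul_le_mul ha hv.le (abs_nonneg v) zero_le_one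
      nlinarith
    have hc := Real.cos_nonneg_of_mem_Icc ⟨neg_le_of_abs_le habs, le_of_abs_le habs⟩
    have := mul_nonneg (Real.exp_pos (-(2 * Real.pi * v))).le hc
    linarith [le_abs_self (1 + Real.exp (-(2 * Real.pi * v)) * Real.cos (2 * Real.pi * a * v))]
  · rcases le_abs.1 hv with hv | hv
    · have h3 := norm_sub_le_norm_add (1 : ℂ) (((Real.exp (-(2 * Real.pi * v)) : ℝ) : ℂ) *
        Complex.exp ((2 * Real.pi * a * v : ℝ) * Complex.I))
      rw [hn, norm_one] at h3
      have h4 : Real.exp (-(2 * Real.pi * v)) ≤ Real.exp (-(Real.pi / 2)) :=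
        Real.exp_le_exp.2 (by nlinarith)
      have h5 : Real.exp (-(Real.pi / 2)) ≤ 1 / 2 := by
        rw [Real.exp_neg, one_div]
        exact inv_anti₀ two_pos h2
      linarith
    · have h3 := norm_sub_le_norm_add (((Real.exp (-(2 * Real.pi * v)) : ℝ) : ℂ) *
        Complex.exp ((2 * Real.pi * a * v : ℝ) * Complex.I)) 1
      rw [hn, norm_one, add_comm] at h3
      have h4 : Real.exp (Real.pi / 2) ≤ Real.exp (-(2 * Real.pi * v)) :=
        Real.exp_le_exp.2 (by nlinarith)
      linarith

theorem one_sub_exp_linePoint_ne_zero {a : ℝ} (ha : |a| ≤ 1) (v : ℝ) :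
    1 - Complex.exp (2 * Real.pi * Complex.I * linePoint a v) ≠ 0 := by
  rw [← norm_pos_iff]
  linarith [half_le_norm_one_sub_exp ha v]

theorem norm_inv_cpow_linePoint_le {s : ℝ} (hs : 0 ≤ s) {a : ℝ} (ha : |a| ≤ 1) (v : ℝ) :
    ‖(linePoint a v ^ (s : ℂ))⁻¹‖ ≤ 6 ^ s * (1 + |v|) ^ (-s) := by
  have h0 : 0 < 1 + |v| := by positivity
  rw [norm_inv, Complex.norm_cpow_real, Real.rpow_neg h0.le]
  have h := Real.rpow_le_rpow (by positivity) (le_norm_linePoint ha v) hs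
  rw [Real.div_rpow h0.le (by norm_num)] at h
  calc (‖linePoint a v‖ ^ s)⁻¹ ≤ ((1 + |v|) ^ s / 6 ^ s)⁻¹ := inv_anti₀ (by positivity) h
    _ = 6 ^ s * ((1 + |v|) ^ s)⁻¹ := by rw [inv_div, div_eq_mul_inv]

theorem norm_kernel_linePoint_le {s : ℝ} (hs : 0 ≤ s) {a : ℝ} (ha : |a| ≤ 1) (v : ℝ) :
    ‖kernel s (linePoint a v)‖ ≤ 2 * 6 ^ s * (1 + |v|) ^ (-s) := by
  rw [kernel, mul_inv, norm_mul]
  have h1 := norm_inv_cpow_linePoint_le hs ha v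
  have h2 : ‖(1 - Complex.exp (2 * Real.pi * Complex.I * linePoint a v))⁻¹‖ ≤ 2 := by
    rw [norm_inv]
    exact inv_le_of_inv_le₀ two_pos (by linarith [half_le_norm_one_sub_exp ha v])
  calc _ ≤ (6 ^ s * (1 + |v|) ^ (-s)) * 2 := mul_le_mul h1 h2 (norm_nonneg _) (by positivity)
    _ = _ := by ring

theorem differentiableAt_inv_cpow_linePoint (s a v : ℝ) :
    DifferentiableAt ℂ (fun z : ℂ => (z ^ (s : ℂ))⁻¹) (linePoint a v) := by
  refine DifferentiableAt.inv ?_ ?_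
  · exact differentiableAt_id.cpow_const (linePoint_mem_slitPlane a v)
  · rw [Complex.cpow_ne_zero_iff]
    exact Or.inl (linePoint_ne_zero a v)

theorem differentiableAt_kernel_linePoint (s : ℝ) {a : ℝ} (ha : |a| ≤ 1) (v : ℝ) :
    DifferentiableAt ℂ (kernel s) (linePoint a v) := by
  unfold kernel
  refine DifferentiableAt.inv (DifferentiableAt.mul ?_ (by fun_prop)) (mul_ne_zero ?_ ?_)
  · exact differentiableAt_id.cpow_const (linePoint_mem_slitPlane a v)
  · rw [Complex.cpow_ne_zero_iff]
    exact Or.inl (linePoint_ne_zero a v)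
  · exact one_sub_exp_linePoint_ne_zero ha v

theorem continuous_linePoint (a : ℝ) : Continuous (linePoint a) := by
  unfold linePoint; fun_prop

theorem continuous_kernel_linePoint (s : ℝ) {a : ℝ} (ha : |a| ≤ 1) :
    Continuous fun v => kernel s (linePoint a v) :=
  continuous_iff_continuousAt.2 fun v =>
    (differentiableAt_kernel_linePoint s ha v).continuousAt.comp (continuous_linePoint a).continuousAt

theorem continuous_inv_cpow_linePoint (s a : ℝ) :
    Continuous fun v => (linePoint a v ^ (s : ℂ))⁻¹ :=
  continuous_iff_continuousAt.2 fun v =>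
    (differentiableAt_inv_cpow_linePoint s a v).continuousAt.comp
      (continuous_linePoint a).continuousAt

theorem integrable_one_add_abs_rpow_neg {s : ℝ} (hs : 1 < s) :
    Integrable fun v : ℝ => (1 + |v|) ^ (-s) := by
  have := integrable_one_add_norm (E := ℝ) (μ := volume) (r := s) (by simpa using hs)
  simpa using this

theorem integrable_kernel_linePoint {s : ℝ} (hs : 1 < s) {a : ℝ} (ha : |a| ≤ 1) :
    Integrable fun v => kernel s (linePoint a v) :=
  ((integrable_one_add_abs_rpow_neg hs).const_mul (2 * 6 ^ s)).mono'
    (continuous_kernel_linePoint s ha).aestronglyMeasurable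
    (.of_forall fun v => norm_kernel_linePoint_le (by linarith) ha v)

theorem integrable_inv_cpow_linePoint {s : ℝ} (hs : 1 < s) {a : ℝ} (ha : |a| ≤ 1) :
    Integrable fun v => (linePoint a v ^ (s : ℂ))⁻¹ :=
  ((integrable_one_add_abs_rpow_neg hs).const_mul (6 ^ s)).mono'
    (continuous_inv_cpow_linePoint s a).aestronglyMeasurable
    (.of_forall fun v => norm_inv_cpow_linePoint_le (by linarith) ha v)

theorem tendsto_one_add_abs_rpow_neg {r : ℝ} (hr : 0 < r) {l : Filter ℝ}
    (hl : Tendsto (fun v : ℝ => |v|) l atTop) :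
    Tendsto (fun v : ℝ => (1 + |v|) ^ (-r)) l (𝓝 0) :=
  (tendsto_rpow_neg_atTop hr).comp (tendsto_atTop_add_const_left l 1 hl)

theorem hasDerivAt_linePoint (a v : ℝ) :
    HasDerivAt (linePoint a) ((a : ℂ) + Complex.I) v := by
  unfold linePoint
  simpa using ((Complex.ofRealCLM.hasDerivAt (x := v)).const_mul ((a : ℂ) + Complex.I)).const_add
    (1 / 2 : ℂ)

theorem integral_inv_cpow_linePoint {s : ℝ} (hs : 1 < s) {a : ℝ} (ha : |a| ≤ 1) :
    ∫ v, (linePoint a v ^ (s : ℂ))⁻¹ = 0 := by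
  have hs' : ((1 - s : ℝ) : ℂ) ≠ 0 := by
    rw [Complex.ofReal_ne_zero]; linarith
  have hd : (a : ℂ) + Complex.I ≠ 0 := fun h => by
    have := congrArg Complex.im h
    simp at this
  have hderiv : ∀ v : ℝ, HasDerivAt
      (fun v => ((a : ℂ) + Complex.I)⁻¹ * ((1 - s : ℝ) : ℂ)⁻¹ * linePoint a v ^ ((1 - s : ℝ) : ℂ))
      ((linePoint a v ^ (s : ℂ))⁻¹) v := by
    intro v
    have h1 := (hasDerivAt_id (linePoint a v)).cpow_const (c := ((1 - s : ℝ) : ℂ))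
      (linePoint_mem_slitPlane a v)
    have h2 := (h1.comp v (hasDerivAt_linePoint a v)).const_mul
      (((a : ℂ) + Complex.I)⁻¹ * ((1 - s : ℝ) : ℂ)⁻¹)
    have : ((1 - s : ℝ) : ℂ) - 1 = -(s : ℂ) := by push_cast; ring
    rw [this, Complex.cpow_neg] at h2
    refine h2.congr_deriv ?_
    simp only [id]
    field_simp
  have hlim : ∀ l : Filter ℝ, Tendsto (fun v : ℝ => |v|) l atTop → Tendsto
      (fun v => ((a : ℂ) + Complex.I)⁻¹ * ((1 - s : ℝ) : ℂ)⁻¹ * linePoint a v ^ ((1 - s : ℝ) : ℂ))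
      l (𝓝 0) := by
    intro l hl
    rw [← mul_zero (((a : ℂ) + Complex.I)⁻¹ * ((1 - s : ℝ) : ℂ)⁻¹)]
    refine Tendsto.const_mul _ ?_
    refine squeeze_zero_norm (a := fun v => 6 ^ (s - 1) * (1 + |v|) ^ (-(s - 1))) (fun v => ?_) ?_
    · have := norm_inv_cpow_linePoint_le (s := s - 1) (by linarith) ha v
      rw [← Complex.cpow_neg, ← Complex.ofReal_neg] at this
      rwa [← neg_sub s 1]
    · simpa using (tendsto_one_add_abs_rpow_neg (r := s - 1) (by linarith) hl).const_mul
        (6 ^ (s - 1) : ℝ)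
  rw [integral_of_hasDerivAt_of_tendsto hderiv (integrable_inv_cpow_linePoint hs ha)
    (hlim atBot tendsto_abs_atBot_atTop) (hlim atTop tendsto_abs_atTop_atTop), sub_zero]

theorem intervalIntegral_shear {f : ℂ → ℂ}
    (hf : ∀ a v : ℝ, |a| ≤ 1 → DifferentiableAt ℂ f (linePoint a v)) (R : ℝ) :
    (∫ v in -R..R, (1 + Complex.I) * f (linePoint 1 v)) -
      (∫ v in -R..R, (-1 + Complex.I) * f (linePoint (-1) v)) =
    (∫ a in (-1 : ℝ)..1, (R : ℂ) * f (linePoint a R)) -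
      ∫ a in (-1 : ℝ)..1, ((-R : ℝ) : ℂ) * f (linePoint a (-R)) := by
  set P : ℝ × ℝ → ℂ := fun p => (p.1 : ℂ) * f (linePoint p.2 p.1) with hP
  set G : ℝ × ℝ → ℂ := fun p => -(((p.2 : ℂ) + Complex.I) * f (linePoint p.2 p.1)) with hG
  have hcomp : ∀ p : ℝ × ℝ, |p.2| ≤ 1 →
      DifferentiableAt ℝ (fun p : ℝ × ℝ => f (linePoint p.2 p.1)) p := by
    intro p hp
    have h1 : DifferentiableAt ℝ (fun p : ℝ × ℝ => linePoint p.2 p.1) p := by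
      unfold linePoint
      have e1 : DifferentiableAt ℝ (fun p : ℝ × ℝ => (p.1 : ℂ)) p :=
        Complex.ofRealCLM.differentiableAt.comp p differentiableAt_fst
      have e2 : DifferentiableAt ℝ (fun p : ℝ × ℝ => (p.2 : ℂ)) p :=
        Complex.ofRealCLM.differentiableAt.comp p differentiableAt_snd
      fun_prop
    exact ((hf p.2 p.1 hp).restrictScalars ℝ).comp p h1
  have hPd : ∀ p : ℝ × ℝ, |p.2| ≤ 1 → DifferentiableAt ℝ P p := fun p hp =>
    (Complex.ofRealCLM.differentiableAt.comp p differentiableAt_fst).mul (hcomp p hp)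
  have hGd : ∀ p : ℝ × ℝ, |p.2| ≤ 1 → DifferentiableAt ℝ G p := fun p hp =>
    (((Complex.ofRealCLM.differentiableAt.comp p differentiableAt_snd).add_const _).mul
      (hcomp p hp)).neg
  have hzero : ∀ p : ℝ × ℝ, |p.2| ≤ 1 → fderiv ℝ P p (1, 0) + fderiv ℝ G p (0, 1) = 0 := by
    rintro ⟨v, a⟩ hp
    obtain ⟨f', hf'⟩ : ∃ f', HasDerivAt f f' (linePoint a v) := ⟨_, (hf a v hp).hasDerivAt⟩
    have e1 : HasDerivAt (fun t : ℝ => P (t, a)) (fderiv ℝ P (v, a) (1, 0)) v :=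
      HasFDerivAt.comp_hasDerivAt (f := fun t : ℝ => (t, a)) v (hPd (v, a) hp).hasFDerivAt
        ((hasDerivAt_id v).prodMk (hasDerivAt_const v a))
    have e2 : HasDerivAt (fun t : ℝ => G (v, t)) (fderiv ℝ G (v, a) (0, 1)) a :=
      HasFDerivAt.comp_hasDerivAt (f := fun t : ℝ => (v, t)) a (hGd (v, a) hp).hasFDerivAt
        ((hasDerivAt_const a v).prodMk (hasDerivAt_id a))
    have d1 : HasDerivAt (fun t : ℝ => P (t, a)) _ v :=
      (Complex.ofRealCLM.hasDerivAt (x := v)).mul (hf'.comp v (hasDerivAt_linePoint a v))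
    have hl : HasDerivAt (fun t : ℝ => linePoint t v) (v : ℂ) a := by
      unfold linePoint
      simpa using (((Complex.ofRealCLM.hasDerivAt (x := a)).add_const Complex.I).mul_const
        (v : ℂ)).const_add (1 / 2 : ℂ)
    have d2 : HasDerivAt (fun t : ℝ => G (v, t)) _ a :=
      (((Complex.ofRealCLM.hasDerivAt (x := a)).add_const Complex.I).mul (hf'.comp a hl)).neg
    rw [e1.unique d1, e2.unique d2]
    simp
    ring
  have huIcc : ∀ p : ℝ × ℝ, p ∈ Set.uIcc (-R) R ×ˢ Set.uIcc (-1 : ℝ) 1 → |p.2| ≤ 1 := by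
    rintro p ⟨-, hp⟩
    rw [Set.uIcc_of_le (by norm_num)] at hp
    exact abs_le.2 hp
  have huIoo : ∀ p : ℝ × ℝ, p ∈ Set.Ioo (min (-R) R) (max (-R) R) ×ˢ
      Set.Ioo (min (-1 : ℝ) 1) (max (-1 : ℝ) 1) → |p.2| ≤ 1 := by
    rintro p ⟨-, hp⟩
    rw [min_eq_left (by norm_num), max_eq_right (by norm_num)] at hp
    exact abs_le.2 ⟨hp.1.le, hp.2.le⟩
  have key := integral2_divergence_prod_of_hasFDerivAt P G (fderiv ℝ P) (fderiv ℝ G) (-R) (-1) R 1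
    (fun p hp => (hPd p (huIcc p hp)).continuousAt.continuousWithinAt)
    (fun p hp => (hGd p (huIcc p hp)).continuousAt.continuousWithinAt)
    (fun p hp => (hPd p (huIoo p hp)).hasFDerivAt)
    (fun p hp => (hGd p (huIoo p hp)).hasFDerivAt)
    (IntegrableOn.congr_fun integrableOn_zero (fun p hp => (hzero p (huIcc p hp)).symm)
      (measurableSet_uIcc.prod measurableSet_uIcc))
  have hdiv : ∫ x in -R..R, ∫ y in (-1 : ℝ)..1,
      fderiv ℝ P (x, y) (1, 0) + fderiv ℝ G (x, y) (0, 1) = 0 := by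
    have : ∀ x : ℝ, ∫ y in (-1 : ℝ)..1,
        fderiv ℝ P (x, y) (1, 0) + fderiv ℝ G (x, y) (0, 1) = 0 := by
      intro x
      rw [intervalIntegral.integral_congr (g := fun _ => (0 : ℂ)), intervalIntegral.integral_zero]
      intro y hy
      rw [Set.uIcc_of_le (by norm_num)] at hy
      exact hzero (x, y) (abs_le.2 hy)
    simp only [this, intervalIntegral.integral_zero]
  rw [hdiv] at key
  simp only [hP, hG, intervalIntegral.integral_neg, Complex.ofReal_one, Complex.ofReal_neg] at key ⊢
  linear_combination key

theorem integral_shear {f : ℂ → ℂ} {s C : ℝ} (hs : 1 < s)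
    (hf : ∀ a v : ℝ, |a| ≤ 1 → DifferentiableAt ℂ f (linePoint a v))
    (hb : ∀ a v : ℝ, |a| ≤ 1 → ‖f (linePoint a v)‖ ≤ C * (1 + |v|) ^ (-s)) :
    ∫ v, (1 + Complex.I) * f (linePoint 1 v) = ∫ v, (-1 + Complex.I) * f (linePoint (-1) v) := by
  have hi : ∀ a : ℝ, |a| ≤ 1 → Integrable fun v => f (linePoint a v) := fun a ha =>
    ((integrable_one_add_abs_rpow_neg hs).const_mul C).mono'
      (continuous_iff_continuousAt.2 fun v => (hf a v ha).continuousAt.comp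
        (continuous_linePoint a).continuousAt).aestronglyMeasurable
      (.of_forall fun v => hb a v ha)
  have h1 := intervalIntegral_tendsto_integral ((hi 1 (by norm_num)).const_mul (1 + Complex.I))
    tendsto_neg_atTop_atBot tendsto_id
  have h2 := intervalIntegral_tendsto_integral ((hi (-1) (by norm_num)).const_mul (-1 + Complex.I))
    tendsto_neg_atTop_atBot tendsto_id
  have h3 := h1.sub h2
  have hside : ∀ (R r : ℝ), |r| = R → ‖∫ a in (-1 : ℝ)..1, (r : ℂ) * f (linePoint a r)‖ ≤
      2 * C * (1 + |R|) ^ (-(s - 1)) := by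
    intro R r hr
    have hR : 0 ≤ R := hr ▸ abs_nonneg r
    have h0 : 0 < 1 + R := by positivity
    have hC : 0 ≤ C * (1 + R) ^ (-s) :=
      hr ▸ (norm_nonneg _).trans (hb 0 r (by norm_num))
    have := intervalIntegral.norm_integral_le_of_norm_le_const (a := -1) (b := 1)
      (f := fun a : ℝ => (r : ℂ) * f (linePoint a r)) (C := (1 + R) * (C * (1 + R) ^ (-s))) ?_
    · refine this.trans (le_of_eq ?_)
      rw [abs_of_nonneg hR, neg_sub, show 1 - s = 1 + -s by ring, Real.rpow_add h0, Real.rpow_one]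
      norm_num
      ring
    · intro a ha
      rw [Set.uIoc_of_le (by norm_num)] at ha
      rw [norm_mul, Complex.norm_real, Real.norm_eq_abs, hr]
      have := hb a r (abs_le.2 ⟨ha.1.le, ha.2⟩)
      rw [hr] at this
      exact mul_le_mul (by linarith) this (norm_nonneg _) h0.le
  have h4 : Tendsto (fun R : ℝ => (∫ v in -R..R, (1 + Complex.I) * f (linePoint 1 v)) -
      (∫ v in -R..R, (-1 + Complex.I) * f (linePoint (-1) v))) atTop (𝓝 0) := by
    refine squeeze_zero_norm' (a := fun R => 2 * (2 * C * (1 + |R|) ^ (-(s - 1)))) ?_ ?_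
    · filter_upwards [eventually_ge_atTop 0] with R hR
      rw [intervalIntegral_shear hf]
      refine (norm_sub_le _ _).trans ?_
      have e1 := hside R R (abs_of_nonneg hR)
      have e2 := hside R (-R) (by rw [abs_neg, abs_of_nonneg hR])
      linarith
    · simpa using ((tendsto_one_add_abs_rpow_neg (r := s - 1) (by linarith)
        tendsto_abs_atTop_atTop).const_mul (2 * C)).const_mul 2
  exact sub_eq_zero.1 (tendsto_nhds_unique h3 h4)

theorem conj_linePoint (v : ℝ) : (starRingEnd ℂ) (linePoint 1 v) = linePoint (-1) (-v) := by
  apply Complex.ext <;> simp [linePoint_re, linePoint_im]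

theorem conj_kernel_linePoint (s v : ℝ) :
    (starRingEnd ℂ) (kernel s (linePoint 1 v)) =
      (linePoint (-1) (-v) ^ (s : ℂ))⁻¹ - kernel s (linePoint (-1) (-v)) := by
  have h1 := one_sub_exp_linePoint_ne_zero (a := -1) (by norm_num) (-v)
  rw [kernel, kernel, map_inv₀, map_mul, map_sub, map_one, ← Complex.exp_conj, ← conj_linePoint]
  rw [← conj_linePoint] at h1
  have hpow : (starRingEnd ℂ) (linePoint 1 v ^ (s : ℂ)) =
      (starRingEnd ℂ) (linePoint 1 v) ^ (s : ℂ) := by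
    have := Complex.cpow_conj ((starRingEnd ℂ) (linePoint 1 v)) (s : ℂ) (by
      rw [conj_linePoint]
      exact Complex.slitPlane_arg_ne_pi (linePoint_mem_slitPlane _ _))
    rw [Complex.conj_conj, Complex.conj_ofReal] at this
    exact this.symm
  have hexp : Complex.exp ((starRingEnd ℂ) (2 * Real.pi * Complex.I * linePoint 1 v)) =
      (Complex.exp (2 * Real.pi * Complex.I * (starRingEnd ℂ) (linePoint 1 v)))⁻¹ := by
    rw [← Complex.exp_neg]
    congr 1
    simp [Complex.conj_ofNat]
  rw [hpow, hexp]
  have h2 := Complex.exp_ne_zero (2 * Real.pi * Complex.I * (starRingEnd ℂ) (linePoint 1 v))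
  have h3 : (starRingEnd ℂ) (linePoint 1 v) ^ (s : ℂ) ≠ 0 := by
    rw [Complex.cpow_ne_zero_iff, conj_linePoint]
    exact Or.inl (linePoint_ne_zero _ _)
  generalize Complex.exp (2 * Real.pi * Complex.I * (starRingEnd ℂ) (linePoint 1 v)) = E at *
  have h4 : 1 - E⁻¹ ≠ 0 := fun h => h1 (by
    rw [sub_eq_zero] at h ⊢
    rw [← inv_inv E, ← h, inv_one])
  have h5 : E - 1 ≠ 0 := fun h => h1 (by rw [← neg_sub, h, neg_zero])
  rw [show 1 - E⁻¹ = (E - 1) / E by field_simp]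
  field_simp
  ring

theorem conj_integral_kernel {s : ℝ} (hs : 1 < s) :
    (starRingEnd ℂ) (∫ v, (1 + Complex.I) * kernel s (linePoint 1 v)) =
      ∫ v, (1 + Complex.I) * kernel s (linePoint 1 v) := by
  have ha : |(-1 : ℝ)| ≤ 1 := by norm_num
  calc (starRingEnd ℂ) (∫ v, (1 + Complex.I) * kernel s (linePoint 1 v))
      = ∫ v, (1 - Complex.I) *
          ((linePoint (-1) (-v) ^ (s : ℂ))⁻¹ - kernel s (linePoint (-1) (-v))) := by
        rw [← integral_conj]
        congr 1 with v
        rw [map_mul, conj_kernel_linePoint]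
        simp [sub_eq_add_neg]
    _ = ∫ v, (1 - Complex.I) *
          ((linePoint (-1) v ^ (s : ℂ))⁻¹ - kernel s (linePoint (-1) v)) :=
        integral_neg_eq_self (fun v => (1 - Complex.I) *
          ((linePoint (-1) v ^ (s : ℂ))⁻¹ - kernel s (linePoint (-1) v))) volume
    _ = ∫ v, (-1 + Complex.I) * kernel s (linePoint (-1) v) := by
        rw [integral_const_mul, integral_const_mul,
          integral_sub (integrable_inv_cpow_linePoint hs ha) (integrable_kernel_linePoint hs ha),
          integral_inv_cpow_linePoint hs ha]
        ring
    _ = _ := (integral_shear hs (fun a v ha => differentiableAt_kernel_linePoint s ha v)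
        (fun a v ha => norm_kernel_linePoint_le (by linarith) ha v)).symm

theorem integrable_sq_mul_exp_neg_mul_sq {c : ℝ} (hc : 0 < c) :
    Integrable fun u : ℝ => u ^ 2 * Real.exp (-c * u ^ 2) := by
  have := integrable_rpow_mul_exp_neg_mul_sq hc (s := 2) (by norm_num)
  simpa using this

theorem norm_exp_mul_ofReal_le {q : ℂ} {r y : ℝ} (hr : q.re ≤ r) (hy : 0 ≤ y) :
    ‖Complex.exp (q * y)‖ ≤ Real.exp (r * y) := by
  rw [Complex.norm_exp, Complex.re_mul_ofReal]
  exact Real.exp_le_exp.2 (mul_le_mul_of_nonneg_right hr hy)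

section LaplaceGaussian

variable {h q : ℝ → ℂ} {C M K b y : ℝ}

theorem integrable_mul_exp_of_re_le (hm : AEStronglyMeasurable h) (hC : ∀ u, ‖h u‖ ≤ C)
    (hq : Continuous q) (hre : ∀ u, (q u).re ≤ K - b * u ^ 2) (hb : 0 < b) (hy : 0 < y) :
    Integrable fun u => h u * Complex.exp (q u * y) := by
  have hC0 : 0 ≤ C := (norm_nonneg _).trans (hC 0)
  refine ((integrable_exp_neg_mul_sq (mul_pos hb hy)).const_mul (C * Real.exp (K * y))).mono'
    (hm.mul (by fun_prop)) (.of_forall fun u => ?_)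
  rw [norm_mul]
  refine (mul_le_mul (hC u) (norm_exp_mul_ofReal_le (hre u) hy.le) (norm_nonneg _) hC0).trans
    (le_of_eq ?_)
  rw [mul_assoc, ← Real.exp_add]
  ring_nf

theorem hasDerivAt_integral_mul_exp (hm : AEStronglyMeasurable h) (hC : ∀ u, ‖h u‖ ≤ C)
    (hq : Continuous q) (hM : ∀ u, ‖q u‖ ≤ M * (1 + u ^ 2))
    (hre : ∀ u, (q u).re ≤ K - b * u ^ 2) (hK : 0 ≤ K) (hb : 0 < b) (hy : 0 < y) :
    HasDerivAt (fun y : ℝ => ∫ u, h u * Complex.exp (q u * y))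
      (∫ u, h u * (q u * Complex.exp (q u * y))) y := by
  have hC0 : 0 ≤ C := (norm_nonneg _).trans (hC 0)
  have hM0 : 0 ≤ M := by simpa using (norm_nonneg _).trans (hM 0)
  have hbound : Integrable fun u : ℝ => C * M * Real.exp (K * (2 * y)) *
      (Real.exp (-(b * (y / 2)) * u ^ 2) + u ^ 2 * Real.exp (-(b * (y / 2)) * u ^ 2)) :=
    ((integrable_exp_neg_mul_sq (by positivity)).add
      (integrable_sq_mul_exp_neg_mul_sq (by positivity))).const_mul _
  refine (hasDerivAt_integral_of_dominated_loc_of_deriv_le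
    (F := fun (y : ℝ) u => h u * Complex.exp (q u * y))
    (F' := fun (y : ℝ) u => h u * (q u * Complex.exp (q u * y)))
    (Ioo_mem_nhds (half_lt_self hy) (by linarith : y < 2 * y))
    (.of_forall fun y => hm.mul (by fun_prop)) (integrable_mul_exp_of_re_le hm hC hq hre hb hy)
    (hm.mul (by fun_prop)) (.of_forall fun u x hx => ?_) hbound (.of_forall fun u x _ => ?_)).2
  · have hx0 : 0 < x := by linarith [hx.1]
    rw [norm_mul, norm_mul]
    have e : ‖Complex.exp (q u * x)‖ ≤
        Real.exp (K * (2 * y)) * Real.exp (-(b * (y / 2)) * u ^ 2) := by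
      refine (norm_exp_mul_ofReal_le (hre u) hx0.le).trans ?_
      rw [← Real.exp_add]
      refine Real.exp_le_exp.2 ?_
      have e1 : K * x ≤ K * (2 * y) := mul_le_mul_of_nonneg_left hx.2.le hK
      have e2 : b * u ^ 2 * (y / 2) ≤ b * u ^ 2 * x :=
        mul_le_mul_of_nonneg_left hx.1.le (by positivity)
      linarith
    calc ‖h u‖ * (‖q u‖ * ‖Complex.exp (q u * x)‖)
        ≤ C * ((M * (1 + u ^ 2)) *
            (Real.exp (K * (2 * y)) * Real.exp (-(b * (y / 2)) * u ^ 2))) := by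
          gcongr
          · exact hC u
          · exact hM u
      _ = _ := by ring
  · have h1 : HasDerivAt (fun x : ℝ => q u * (x : ℂ)) (q u) x := by
      simpa using (Complex.ofRealCLM.hasDerivAt (x := x)).const_mul (q u)
    have := (h1.cexp).const_mul (h u)
    rwa [mul_comm (Complex.exp _)] at this

end LaplaceGaussian

theorem ρ_eq : ρ = (1 + Complex.I) / (√2 : ℝ) := by
  have h : ρ = Complex.exp ((Real.pi / 4 : ℝ) * Complex.I) := by
    rw [ρ]; congr 1; push_cast; ring
  rw [h, Complex.exp_mul_I, ← Complex.ofReal_cos, ← Complex.ofReal_sin, Real.cos_pi_div_four,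
    Real.sin_pi_div_four]
  have h2 : ((√2 : ℝ) : ℂ) ^ 2 = 2 := by
    rw [← Complex.ofReal_pow, Real.sq_sqrt (by norm_num)]; simp
  have h3 : ((√2 : ℝ) : ℂ) ≠ 0 := by
    rw [Complex.ofReal_ne_zero]; positivity
  field_simp
  push_cast
  linear_combination (1 + Complex.I) / 2 * h2

theorem half_add_ρ_mul (u : ℝ) : (1 : ℂ) / 2 + ρ * u = linePoint 1 (u / √2) := by
  rw [ρ_eq, linePoint]
  push_cast
  ring

/-- The contour-integral part of `Ω_s(x)` for `x > 0`, parametrised by the imaginary part. -/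
noncomputable def contourPart (s x : ℝ) : ℂ :=
  ∫ v : ℝ, (1 + Complex.I) * kernel s (linePoint 1 v) *
    Complex.exp (Real.pi * Complex.I * linePoint 1 v ^ 2 * x)

theorem integral_eq_contourPart (s x : ℝ) :
    (∫ u : ℝ, ρ *
      (Complex.exp (Real.pi * Complex.I * ((1 : ℂ) / 2 + ρ * (u : ℂ)) ^ 2 * (x : ℂ)
            + 2 * Real.pi * Complex.I * ((1 : ℂ) / 2 + ρ * (u : ℂ)) * (Int.fract (0 : ℝ) : ℝ)) /
        (((1 : ℂ) / 2 + ρ * (u : ℂ)) ^ (s : ℂ) *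
          (1 - Complex.exp (2 * Real.pi * Complex.I * ((1 : ℂ) / 2 + ρ * (u : ℂ))))))) =
      contourPart s x := by
  have h2 : (0 : ℝ) < √2 := by positivity
  have key := Measure.integral_comp_div (fun v => ρ * (kernel s (linePoint 1 v) *
    Complex.exp (Real.pi * Complex.I * linePoint 1 v ^ 2 * x))) √2
  rw [abs_of_pos h2, ← integral_smul] at key
  rw [contourPart]
  convert key using 3 with u u
  · rw [half_add_ρ_mul, kernel, Int.fract_zero]
    simp only [Complex.ofReal_zero, mul_zero, add_zero]
    ring
  · have h3 : ((√2 : ℝ) : ℂ) ≠ 0 := by exact_mod_cast h2.ne'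
    rw [ρ_eq, Complex.real_smul]
    field_simp

theorem re_pi_mul_I_mul_linePoint_sq (v : ℝ) :
    (Real.pi * Complex.I * linePoint 1 v ^ 2).re = -(Real.pi * (v + 2 * v ^ 2)) := by
  rw [mul_assoc, Complex.re_ofReal_mul, Complex.I_mul_re, pow_two, Complex.mul_im, linePoint_re,
    linePoint_im]
  ring

theorem re_pi_mul_I_mul_linePoint_sq_le (v : ℝ) :
    (Real.pi * Complex.I * linePoint 1 v ^ 2).re ≤ Real.pi - Real.pi * v ^ 2 := by
  rw [re_pi_mul_I_mul_linePoint_sq]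
  nlinarith [Real.pi_pos, sq_nonneg (v + 1 / 2), mul_nonneg Real.pi_pos.le (sq_nonneg (v + 1 / 2))]

theorem norm_pi_mul_I_mul_linePoint_sq_le (v : ℝ) :
    ‖Real.pi * Complex.I * linePoint 1 v ^ 2‖ ≤ 4 * Real.pi * (1 + v ^ 2) := by
  rw [norm_mul, norm_mul, Complex.norm_I, Complex.norm_real, Real.norm_eq_abs,
    abs_of_pos Real.pi_pos, norm_pow, ← Complex.normSq_eq_norm_sq, Complex.normSq_apply,
    linePoint_re, linePoint_im]
  nlinarith [Real.pi_pos, mul_nonneg Real.pi_pos.le (sq_nonneg (v - 1 / 4)),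
    mul_nonneg Real.pi_pos.le (sq_nonneg v)]

theorem norm_contour_coeff_le {s : ℝ} (hs : 0 ≤ s) (v : ℝ) :
    ‖(1 + Complex.I) * kernel s (linePoint 1 v)‖ ≤
      ‖1 + Complex.I‖ * (2 * 6 ^ s) * (1 + |v|) ^ (-s) := by
  rw [norm_mul, mul_assoc]
  exact mul_le_mul_of_nonneg_left (norm_kernel_linePoint_le hs (by norm_num) v) (norm_nonneg _)

theorem differentiableAt_contourPart {s : ℝ} (hs : 0 ≤ s) {x : ℝ} (hx : 0 < x) :
    DifferentiableAt ℝ (contourPart s) x := by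
  have hc := continuous_kernel_linePoint s (a := 1) (by norm_num)
  have hl := continuous_linePoint 1
  refine (hasDerivAt_integral_mul_exp (h := fun v => (1 + Complex.I) * kernel s (linePoint 1 v))
    (q := fun v => Real.pi * Complex.I * linePoint 1 v ^ 2) (C := ‖1 + Complex.I‖ * (2 * 6 ^ s))
    (continuous_const.mul hc).aestronglyMeasurable (fun v => ?_) (by fun_prop) norm_pi_mul_I_mul_linePoint_sq_le
    re_pi_mul_I_mul_linePoint_sq_le Real.pi_pos.le Real.pi_pos hx).differentiableAt
  refine (norm_contour_coeff_le hs v).trans (mul_le_of_le_one_right (by positivity) ?_)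
  exact Real.rpow_le_one_of_one_le_of_nonpos (by linarith [abs_nonneg v]) (by linarith)

theorem tendsto_contourPart {s : ℝ} (hs : 1 < s) :
    Tendsto (contourPart s) (𝓝[>] 0) (𝓝 (∫ v, (1 + Complex.I) * kernel s (linePoint 1 v))) := by
  have hc := continuous_kernel_linePoint s (a := 1) (by norm_num)
  have hl := continuous_linePoint 1
  refine tendsto_integral_filter_of_dominated_convergence
    (fun v => ‖1 + Complex.I‖ * (2 * 6 ^ s) * (1 + |v|) ^ (-s) * Real.exp Real.pi)
    (.of_forall fun x => by fun_prop) ?_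
    (((integrable_one_add_abs_rpow_neg hs).const_mul _).mul_const _) (.of_forall fun v => ?_)
  · filter_upwards [Ioo_mem_nhdsGT one_pos] with x hx
    refine .of_forall fun v => ?_
    rw [norm_mul]
    refine mul_le_mul (norm_contour_coeff_le (by linarith) v) ?_ (norm_nonneg _) (by positivity)
    refine (norm_exp_mul_ofReal_le (re_pi_mul_I_mul_linePoint_sq_le v) hx.1.le).trans
      (Real.exp_le_exp.2 ?_)
    have h1 : 0 ≤ Real.pi * v ^ 2 * x := by have := Real.pi_pos; have := hx.1; positivity
    nlinarith [Real.pi_pos, hx.2]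
  · have : Continuous fun x : ℝ => (1 + Complex.I) * kernel s (linePoint 1 v) *
        Complex.exp (Real.pi * Complex.I * linePoint 1 v ^ 2 * x) := by fun_prop
    simpa using (this.tendsto 0).mono_left nhdsWithin_le_nhds

theorem ρ_re : ρ.re = √2 / 2 := by
  rw [ρ_eq, Complex.div_ofReal_re]
  rw [Real.sqrt_div_self]
  simp

theorem ρ_im : ρ.im = √2 / 2 := by
  rw [ρ_eq, Complex.div_ofReal_im]
  rw [Real.sqrt_div_self]
  simp

theorem norm_ρ : ‖ρ‖ = 1 := by
  rw [ρ, show (Real.pi : ℂ) * Complex.I / 4 = (Real.pi / 4 : ℝ) * Complex.I by push_cast; ring,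
    Complex.norm_exp_ofReal_mul_I]

theorem one_add_ρ_mul_mem_slitPlane (w : ℝ) : 1 + ρ * w ∈ Complex.slitPlane := by
  rw [Complex.mem_slitPlane_iff, Complex.add_re, Complex.add_im, Complex.re_mul_ofReal,
    Complex.im_mul_ofReal, ρ_re, ρ_im]
  by_cases hw : w = 0
  · left; simp [hw]
  · right
    simp [hw]

theorem half_le_norm_one_add_ρ_mul (w : ℝ) : 1 / 2 ≤ ‖1 + ρ * w‖ := by
  have h1 := Complex.abs_re_le_norm (1 + ρ * w)
  have h2 := Complex.abs_im_le_norm (1 + ρ * w)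
  rw [Complex.add_re, Complex.re_mul_ofReal, ρ_re, Complex.one_re] at h1
  rw [Complex.add_im, Complex.im_mul_ofReal, ρ_im, Complex.one_im, zero_add] at h2
  have h3 := le_abs_self (1 + √2 / 2 * w)
  have h4 := neg_abs_le (√2 / 2 * w)
  linarith

theorem norm_one_add_ρ_mul_cpow_le {r : ℝ} (hr : 0 ≤ r) (w : ℝ) :
    ‖(1 + ρ * w) ^ ((-r : ℝ) : ℂ)‖ ≤ 2 ^ r := by
  have h := half_le_norm_one_add_ρ_mul w
  rw [Complex.norm_cpow_real, Real.rpow_neg (norm_nonneg _), ← Real.inv_rpow (norm_nonneg _)]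
  exact Real.rpow_le_rpow (by positivity) (inv_le_of_inv_le₀ two_pos (by linarith)) hr

theorem hasDerivAt_one_add_ρ_mul_cpow (r w : ℝ) :
    HasDerivAt (fun w : ℝ => (1 + ρ * w) ^ ((-r : ℝ) : ℂ))
      (-r * ρ * (1 + ρ * w) ^ ((-(r + 1) : ℝ) : ℂ)) w := by
  have h1 : HasDerivAt (fun w : ℝ => 1 + ρ * (w : ℂ)) ρ w := by
    simpa using ((Complex.ofRealCLM.hasDerivAt (x := w)).const_mul ρ).const_add 1
  have h2 := ((hasDerivAt_id (1 + ρ * (w : ℂ))).cpow_const (c := ((-r : ℝ) : ℂ))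
      (one_add_ρ_mul_mem_slitPlane w)).comp w h1
  refine h2.congr_deriv ?_
  simp only [id]
  push_cast
  ring_nf

/-- The difference `(1 + ρw)^{-s} - 1`. -/
noncomputable def gap (s w : ℝ) : ℂ := (1 + ρ * w) ^ ((-s : ℝ) : ℂ) - 1

theorem hasDerivAt_gap (s w : ℝ) :
    HasDerivAt (gap s) (-s * ρ * (1 + ρ * w) ^ ((-(s + 1) : ℝ) : ℂ)) w :=
  (hasDerivAt_one_add_ρ_mul_cpow s w).sub_const 1

theorem continuous_gap (s : ℝ) : Continuous (gap s) :=
  continuous_iff_continuousAt.2 fun w => (hasDerivAt_gap s w).continuousAt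

theorem norm_gap_le {s : ℝ} (hs : 0 ≤ s) (w : ℝ) : ‖gap s w‖ ≤ 2 ^ s + 1 := by
  refine (norm_sub_le _ _).trans ?_
  rw [norm_one]
  exact add_le_add_left (norm_one_add_ρ_mul_cpow_le hs w) 1

theorem norm_gap_add_gap_neg_le_sq {s : ℝ} (hs : 0 ≤ s) (w : ℝ) :
    ‖gap s w + gap s (-w)‖ ≤ 2 * (s * (s + 1) * 2 ^ (s + 2)) * w ^ 2 := by
  set φ : ℝ → ℂ := fun w => -s * ρ * (1 + ρ * w) ^ ((-(s + 1) : ℝ) : ℂ) with hφ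
  have hφ' : ∀ w : ℝ, HasDerivAt φ
      (-s * ρ * (-(s + 1 : ℝ) * ρ * (1 + ρ * w) ^ ((-(s + 1 + 1) : ℝ) : ℂ))) w := fun w =>
    (hasDerivAt_one_add_ρ_mul_cpow (s + 1) w).const_mul _
  have hb : ∀ w : ℝ, ‖-s * ρ * (-(s + 1 : ℝ) * ρ * (1 + ρ * w) ^ ((-(s + 1 + 1) : ℝ) : ℂ))‖ ≤
      s * (s + 1) * 2 ^ (s + 2) := by
    intro w
    have h := norm_one_add_ρ_mul_cpow_le (r := s + 1 + 1) (by linarith) w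
    rw [norm_mul, norm_mul, norm_mul, norm_mul, norm_ρ, norm_neg, norm_neg, Complex.norm_real,
      Complex.norm_real, Real.norm_of_nonneg hs, Real.norm_of_nonneg (by linarith), mul_one, mul_one,
      ← mul_assoc]
    rw [show s + 2 = s + 1 + 1 by ring]
    exact mul_le_mul_of_nonneg_left h (by positivity)
  have hφd : ∀ x y : ℝ, ‖φ y - φ x‖ ≤ s * (s + 1) * 2 ^ (s + 2) * ‖y - x‖ := fun x y =>
    Convex.norm_image_sub_le_of_norm_hasDerivWithin_le
      (fun w _ => (hφ' w).hasDerivWithinAt) (fun w _ => hb w) convex_univ (Set.mem_univ x)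
      (Set.mem_univ y)
  have hψ : ∀ w : ℝ, HasDerivAt (fun w => gap s w + gap s (-w)) (φ w - φ (-w)) w := by
    intro w
    have := (hasDerivAt_gap s w).add ((hasDerivAt_gap s (-w)).scomp w (hasDerivAt_neg w))
    refine this.congr_deriv ?_
    simp [hφ, sub_eq_add_neg]
  have h0 : gap s 0 = 0 := by simp [gap]
  have key := Convex.norm_image_sub_le_of_norm_hasDerivWithin_le (s := Set.uIcc 0 w) (x := 0)
    (y := w) (C := s * (s + 1) * 2 ^ (s + 2) * (2 * |w|))
    (fun x _ => (hψ x).hasDerivWithinAt) (fun x hx => ?_) (convex_uIcc 0 w) Set.left_mem_uIcc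
    Set.right_mem_uIcc
  · simp only [neg_zero, h0, add_zero, sub_zero, Real.norm_eq_abs] at key
    refine key.trans (le_of_eq ?_)
    rw [← sq_abs w]
    ring
  · refine (hφd (-x) x).trans ?_
    have hx' : |x| ≤ |w| := by
      have := Set.abs_sub_left_of_mem_uIcc hx
      simpa using this
    rw [sub_neg_eq_add, Real.norm_eq_abs, ← two_mul, abs_mul, abs_two]
    gcongr

theorem inv_cpow_sub_inv_cpow_eq_gap (s : ℝ) {k : ℝ} (hk : 0 < k) (v : ℝ) :
    ((ρ * v + k) ^ (s : ℂ))⁻¹ - ((k : ℂ) ^ (s : ℂ))⁻¹ = ((k : ℂ) ^ (s : ℂ))⁻¹ * gap s (v / k) := by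
  have hk' : (k : ℂ) ≠ 0 := by exact_mod_cast hk.ne'
  have hz := Complex.slitPlane_ne_zero (one_add_ρ_mul_mem_slitPlane (v / k))
  have h : ρ * v + k = k * (1 + ρ * ((v / k : ℝ) : ℂ)) := by
    push_cast
    field_simp
    ring
  rw [gap, h, Complex.ofReal_neg, Complex.cpow_neg, mul_sub, mul_one, ← mul_inv]
  congr 2
  rw [Complex.cpow_def_of_ne_zero (mul_ne_zero hk' hz), Complex.cpow_def_of_ne_zero hk',
    Complex.cpow_def_of_ne_zero hz, Complex.log_ofReal_mul hk hz, Complex.ofReal_log hk.le,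
    ← Complex.exp_add]
  ring_nf

/-- The phase `-π (v² + i (k+1)²)`. -/
noncomputable def phase (k : ℕ) (v : ℝ) : ℂ :=
  -(Real.pi * ((v : ℂ) ^ 2 + Complex.I * ((k : ℂ) + 1) ^ 2))

/-- The Gaussian average of the gap at the integer `k + 1`. -/
noncomputable def gapIntegral (s : ℝ) (k : ℕ) (y : ℝ) : ℂ :=
  ∫ v : ℝ, gap s (v / (k + 1)) * Complex.exp (phase k v * y)

theorem continuous_phase (k : ℕ) : Continuous (phase k) := by
  unfold phase; fun_prop

theorem phase_re (k : ℕ) (v : ℝ) : (phase k v).re = 0 - Real.pi * v ^ 2 := by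
  have h : phase k v = ((-(Real.pi * v ^ 2) : ℝ) : ℂ) +
      ((-(Real.pi * (k + 1) ^ 2) : ℝ) : ℂ) * Complex.I := by
    rw [phase]; push_cast; ring
  rw [h, Complex.add_re, Complex.re_ofReal_mul, Complex.ofReal_re, Complex.I_re]
  ring

theorem norm_phase_le (k : ℕ) (v : ℝ) :
    ‖phase k v‖ ≤ Real.pi * (v ^ 2 + ((k : ℝ) + 1) ^ 2) := by
  rw [phase, norm_neg, norm_mul, Complex.norm_real, Real.norm_of_nonneg Real.pi_pos.le]
  refine mul_le_mul_of_nonneg_left ((norm_add_le _ _).trans (le_of_eq ?_)) Real.pi_pos.le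
  have h : ‖(k : ℂ) + 1‖ = (k : ℝ) + 1 := by
    rw [← Nat.cast_add_one, Complex.norm_natCast, Nat.cast_add_one]
  rw [norm_mul, norm_pow, norm_pow, Complex.norm_I, h, one_mul, Complex.norm_real,
    Real.norm_eq_abs, sq_abs]

theorem norm_phase_le_mul (k : ℕ) (v : ℝ) :
    ‖phase k v‖ ≤ Real.pi * ((k : ℝ) + 1) ^ 2 * (1 + v ^ 2) := by
  refine (norm_phase_le k v).trans ?_
  have h1 : (1 : ℝ) ≤ ((k : ℝ) + 1) ^ 2 := one_le_pow₀ (by linarith [k.cast_nonneg (α := ℝ)])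
  rw [mul_assoc]
  refine mul_le_mul_of_nonneg_left ?_ Real.pi_pos.le
  nlinarith [sq_nonneg v]

theorem norm_exp_phase_le (k : ℕ) (v : ℝ) {y : ℝ} (hy : 0 ≤ y) :
    ‖Complex.exp (phase k v * y)‖ ≤ Real.exp (-(Real.pi * y) * v ^ 2) := by
  refine (norm_exp_mul_ofReal_le (phase_re k v).le hy).trans (le_of_eq ?_)
  ring_nf

theorem continuous_gap_div (s : ℝ) (k : ℕ) : Continuous fun v : ℝ => gap s (v / (k + 1)) :=
  (continuous_gap s).comp (continuous_id.div_const _)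

theorem integrable_gap_mul_exp {s : ℝ} (hs : 0 ≤ s) (k : ℕ) {y : ℝ} (hy : 0 < y) :
    Integrable fun v : ℝ => gap s (v / (k + 1)) * Complex.exp (phase k v * y) :=
  integrable_mul_exp_of_re_le (continuous_gap_div s k).aestronglyMeasurable
    (fun _ => norm_gap_le hs _) (continuous_phase k) (fun v => (phase_re k v).le) Real.pi_pos hy

theorem integral_norm_gap_mul_exp_le {s : ℝ} (hs : 0 ≤ s) (k : ℕ) {y : ℝ} (hy : 0 < y) :
    ∫ v : ℝ, ‖gap s (v / (k + 1)) * Complex.exp (phase k v * y)‖ ≤ (2 ^ s + 1) * √(y⁻¹) := by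
  have hpi := Real.pi_pos
  have h : ∫ v : ℝ, (2 ^ s + 1) * Real.exp (-(Real.pi * y) * v ^ 2) = (2 ^ s + 1) * √(y⁻¹) := by
    rw [integral_const_mul, integral_gaussian]
    congr 2
    field_simp
  rw [← h]
  refine integral_mono (integrable_gap_mul_exp hs k hy).norm
    ((integrable_exp_neg_mul_sq (by positivity)).const_mul _) fun v => ?_
  simp only [norm_mul]
  exact mul_le_mul (norm_gap_le hs _) (norm_exp_phase_le k v hy.le) (norm_nonneg _) (by positivity)

theorem norm_gapIntegral_le {s : ℝ} (hs : 0 ≤ s) (k : ℕ) {y : ℝ} (hy : 0 < y) :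
    ‖gapIntegral s k y‖ ≤ (2 ^ s + 1) * √(y⁻¹) :=
  (norm_integral_le_integral_norm _).trans (integral_norm_gap_mul_exp_le hs k hy)

theorem gapIntegral_eq_symm {s : ℝ} (hs : 0 ≤ s) (k : ℕ) {y : ℝ} (hy : 0 < y) :
    gapIntegral s k y = ∫ v : ℝ, (gap s (v / (k + 1)) + gap s (-(v / (k + 1)))) / 2 *
      Complex.exp (phase k v * y) := by
  have hi := integrable_gap_mul_exp hs k hy
  have hflip : (fun v : ℝ => gap s (-v / (k + 1)) * Complex.exp (phase k (-v) * y)) =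
      fun v : ℝ => gap s (-(v / (k + 1))) * Complex.exp (phase k v * y) := by
    ext v
    rw [neg_div, phase, phase, Complex.ofReal_neg, neg_sq]
  have hi' := hi.comp_neg
  have hneg := integral_neg_eq_self
    (fun v : ℝ => gap s (v / (k + 1)) * Complex.exp (phase k v * y)) volume
  rw [hflip] at hi' hneg
  calc gapIntegral s k y = (1 / 2 : ℂ) * ((∫ v : ℝ, gap s (v / (k + 1)) *
          Complex.exp (phase k v * y)) + ∫ v : ℝ, gap s (-(v / (k + 1))) *
          Complex.exp (phase k v * y)) := by
        rw [hneg, gapIntegral]; ring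
    _ = _ := by
        rw [← integral_add hi hi', ← integral_const_mul]
        congr 1 with v
        ring

theorem exists_hasDerivAt_gapIntegral {s : ℝ} (hs : 0 ≤ s) {y₀ : ℝ} (hy₀ : 0 < y₀) :
    ∃ (g' : ℕ → ℝ → ℂ) (D : ℝ), ∀ k, ∀ y ∈ Set.Ioi y₀,
      HasDerivAt (gapIntegral s k) (g' k y) y ∧ ‖g' k y‖ ≤ D := by
  have hpi := Real.pi_pos
  set C₁ : ℝ := s * (s + 1) * 2 ^ (s + 2) with hC₁
  refine ⟨fun k y => ∫ v : ℝ, (gap s (v / (k + 1)) + gap s (-(v / (k + 1)))) / 2 *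
    (phase k v * Complex.exp (phase k v * y)), ∫ v : ℝ, Real.pi * (2 ^ s + 1 + C₁) *
    (v ^ 2 * Real.exp (-(Real.pi * y₀) * v ^ 2)), fun k y hy => ?_⟩
  have hy : y₀ < y := hy
  have hy0 : 0 < y := hy₀.trans hy
  have hb : ∀ v : ℝ, ‖(gap s (v / (k + 1)) + gap s (-(v / (k + 1)))) / 2‖ ≤ 2 ^ s + 1 := by
    intro v
    rw [norm_div, Complex.norm_ofNat, div_le_iff₀ two_pos]
    refine (norm_add_le _ _).trans ?_
    linarith [norm_gap_le hs (v / (k + 1)), norm_gap_le hs (-(v / (k + 1)))]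
  have hb' : ∀ v : ℝ, ‖(gap s (v / (k + 1)) + gap s (-(v / (k + 1)))) / 2‖ ≤
      C₁ * (v / (k + 1)) ^ 2 := by
    intro v
    rw [norm_div, Complex.norm_ofNat, div_le_iff₀ two_pos]
    refine (norm_gap_add_gap_neg_le_sq hs _).trans (le_of_eq ?_)
    ring
  constructor
  · have hc : Continuous fun v : ℝ => (gap s (v / (k + 1)) + gap s (-(v / (k + 1)))) / 2 :=
      ((continuous_gap_div s k).add ((continuous_gap s).comp
        (continuous_id.div_const _).neg)).div_const 2
    refine (hasDerivAt_integral_mul_exp hc.aestronglyMeasurable hb (continuous_phase k)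
      (norm_phase_le_mul k) (fun v => (phase_re k v).le) le_rfl hpi hy0).congr_of_eventuallyEq ?_
    filter_upwards [lt_mem_nhds hy0] with z hz
    exact gapIntegral_eq_symm hs k hz
  · refine norm_integral_le_of_norm_le
      ((integrable_sq_mul_exp_neg_mul_sq (by positivity)).const_mul _) (.of_forall fun v => ?_)
    have hk : (0 : ℝ) < (k : ℝ) + 1 := by positivity
    have he : ‖Complex.exp (phase k v * y)‖ ≤ Real.exp (-(Real.pi * y₀) * v ^ 2) := by
      refine (norm_exp_phase_le k v hy0.le).trans (Real.exp_le_exp.2 ?_)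
      have : Real.pi * y₀ * v ^ 2 ≤ Real.pi * y * v ^ 2 := by gcongr
      linarith
    have hgp : ‖(gap s (v / (k + 1)) + gap s (-(v / (k + 1)))) / 2‖ * ‖phase k v‖ ≤
        Real.pi * (2 ^ s + 1 + C₁) * v ^ 2 := by
      calc _ ≤ ‖(gap s (v / (k + 1)) + gap s (-(v / (k + 1)))) / 2‖ *
            (Real.pi * (v ^ 2 + ((k : ℝ) + 1) ^ 2)) :=
            mul_le_mul_of_nonneg_left (norm_phase_le k v) (norm_nonneg _)
        _ = Real.pi * (‖(gap s (v / (k + 1)) + gap s (-(v / (k + 1)))) / 2‖ * v ^ 2 +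
            ‖(gap s (v / (k + 1)) + gap s (-(v / (k + 1)))) / 2‖ * ((k : ℝ) + 1) ^ 2) := by ring
        _ ≤ Real.pi * ((2 ^ s + 1) * v ^ 2 + C₁ * (v / (k + 1)) ^ 2 * ((k : ℝ) + 1) ^ 2) := by
            gcongr
            · exact hb v
            · exact hb' v
        _ = _ := by field_simp
    rw [norm_mul, norm_mul, ← mul_assoc, ← mul_assoc]
    exact mul_le_mul hgp he (norm_nonneg _) (by positivity)

theorem norm_inv_natCast_add_one_cpow (s : ℝ) (k : ℕ) :
    ‖(((k : ℂ) + 1) ^ (s : ℂ))⁻¹‖ = (((k + 1 : ℕ) : ℝ) ^ s)⁻¹ := by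
  rw [norm_inv, ← Nat.cast_add_one, Complex.norm_cpow_real, Complex.norm_natCast]

theorem summable_inv_natCast_add_one_rpow {s : ℝ} (hs : 1 < s) :
    Summable fun k : ℕ => (((k + 1 : ℕ) : ℝ) ^ s)⁻¹ :=
  (summable_nat_add_iff 1).2 (Real.summable_nat_rpow_inv.2 hs)

/-- The series of gap integrals weighted by `k^{-s}`. -/
noncomputable def gapSeries (s y : ℝ) : ℂ :=
  ∑' k : ℕ, (((k : ℂ) + 1) ^ (s : ℂ))⁻¹ * gapIntegral s k y

theorem norm_gapSeries_term_le {s : ℝ} (hs : 0 ≤ s) (k : ℕ) {y : ℝ} (hy : 0 < y) :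
    ‖(((k : ℂ) + 1) ^ (s : ℂ))⁻¹ * gapIntegral s k y‖ ≤
      (((k + 1 : ℕ) : ℝ) ^ s)⁻¹ * ((2 ^ s + 1) * √(y⁻¹)) := by
  rw [norm_mul, norm_inv_natCast_add_one_cpow]
  exact mul_le_mul_of_nonneg_left (norm_gapIntegral_le hs k hy) (by positivity)

theorem norm_gapSeries_le {s : ℝ} (hs : 1 < s) {y : ℝ} (hy : 0 < y) :
    ‖gapSeries s y‖ ≤ (∑' k : ℕ, (((k + 1 : ℕ) : ℝ) ^ s)⁻¹) * ((2 ^ s + 1) * √(y⁻¹)) :=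
  tsum_of_norm_bounded ((summable_inv_natCast_add_one_rpow hs).hasSum.mul_right _)
    fun k => norm_gapSeries_term_le (by linarith) k hy

theorem differentiableAt_gapSeries {s : ℝ} (hs : 1 < s) {y : ℝ} (hy : 0 < y) :
    DifferentiableAt ℝ (gapSeries s) y := by
  have hs0 : 0 ≤ s := by linarith
  obtain ⟨g', D, hD⟩ := exists_hasDerivAt_gapIntegral hs0 (half_pos hy)
  have hmem : y ∈ Set.Ioi (y / 2) := half_lt_self hy
  exact (hasDerivAt_tsum_of_isPreconnected
    (g := fun (k : ℕ) y => (((k : ℂ) + 1) ^ (s : ℂ))⁻¹ * gapIntegral s k y)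
    (g' := fun (k : ℕ) y => (((k : ℂ) + 1) ^ (s : ℂ))⁻¹ * g' k y)
    ((summable_inv_natCast_add_one_rpow hs).mul_right D)
    isOpen_Ioi isPreconnected_Ioi (fun k z hz => ((hD k z hz).1).const_mul _)
    (fun k z hz => by
      rw [norm_mul, norm_inv_natCast_add_one_cpow]
      exact mul_le_mul_of_nonneg_left (hD k z hz).2 (by positivity))
    hmem
    (Summable.of_norm_bounded ((summable_inv_natCast_add_one_rpow hs).mul_right _)
      fun k => norm_gapSeries_term_le hs0 k hy) hmem).differentiableAt

theorem integral_tsum_eq_gapSeries {s : ℝ} (hs : 1 < s) {x : ℝ} (hx : 0 < x) :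
    (∫ u : ℝ, ((Real.exp (-(Real.pi * x * u ^ 2)) : ℝ) : ℂ) *
      ∑' k : ℕ, Complex.exp (-(Real.pi * Complex.I *
          (((k : ℂ) + 1) - (Int.fract (0 : ℝ) : ℝ)) ^ 2 / (x : ℂ))) *
        (((ρ * (x : ℂ) * (u : ℂ) + ((k : ℂ) + 1) - (Int.fract (0 : ℝ) : ℝ)) ^ (s : ℂ))⁻¹
          - (((k : ℂ) + 1) ^ (s : ℂ))⁻¹)) = (x : ℂ)⁻¹ * gapSeries s x⁻¹ := by
  have hs0 : 0 ≤ s := by linarith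
  have hy : 0 < x⁻¹ := inv_pos.2 hx
  have hx' : (x : ℂ) ≠ 0 := by exact_mod_cast hx.ne'
  set J : ℕ → ℝ → ℂ := fun k v => (((k : ℂ) + 1) ^ (s : ℂ))⁻¹ *
    (gap s (v / (k + 1)) * Complex.exp (phase k v * (x⁻¹ : ℝ))) with hJ
  have hswap : ∑' k, ∫ v, J k v = ∫ v, ∑' k, J k v := by
    refine integral_tsum_of_summable_integral_norm
      (fun k => (integrable_gap_mul_exp hs0 k hy).const_mul _) ?_
    refine Summable.of_nonneg_of_le (fun k => integral_nonneg fun v => norm_nonneg _) (fun k => ?_)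
      ((summable_inv_natCast_add_one_rpow hs).mul_right ((2 ^ s + 1) * √(x⁻¹⁻¹)))
    simp only [hJ]
    simp_rw [norm_mul (((k : ℂ) + 1) ^ (s : ℂ))⁻¹]
    rw [integral_const_mul, norm_inv_natCast_add_one_cpow]
    exact mul_le_mul_of_nonneg_left (integral_norm_gap_mul_exp_le hs0 k hy) (by positivity)
  have hseries : gapSeries s x⁻¹ = ∫ v, ∑' k, J k v := by
    rw [← hswap, gapSeries]
    congr 1 with k
    rw [hJ, integral_const_mul, gapIntegral]
  have hscale := Measure.integral_comp_mul_left (fun v => ∑' k, J k v) x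
  rw [← hseries, abs_of_pos hy, Complex.real_smul, Complex.ofReal_inv] at hscale
  rw [← hscale]
  congr 1 with u
  rw [← tsum_mul_left]
  congr 1 with k
  have hk : (0 : ℝ) < (k : ℝ) + 1 := by positivity
  have hgap := inv_cpow_sub_inv_cpow_eq_gap s hk (x * u)
  have hbase : ρ * (x : ℂ) * (u : ℂ) + ((k : ℂ) + 1) - ((Int.fract (0 : ℝ) : ℝ) : ℂ) =
      ρ * ((x * u : ℝ) : ℂ) + (((k : ℝ) + 1 : ℝ) : ℂ) := by
    rw [Int.fract_zero]; push_cast; ring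
  have hexp : ((Real.exp (-(Real.pi * x * u ^ 2)) : ℝ) : ℂ) * Complex.exp (-(Real.pi * Complex.I *
      (((k : ℂ) + 1) - ((Int.fract (0 : ℝ) : ℝ) : ℂ)) ^ 2 / (x : ℂ))) =
      Complex.exp (phase k (x * u) * (x⁻¹ : ℝ)) := by
    rw [Complex.ofReal_exp, ← Complex.exp_add, phase, Int.fract_zero]
    congr 1
    push_cast
    field_simp
    ring
  rw [← mul_assoc, hexp, hbase]
  push_cast at hgap ⊢
  rw [hgap]
  simp only [hJ]
  push_cast
  ring

/-- The correction term of `Ω_s(x)` for `x > 0`. -/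
noncomputable def correction (s x : ℝ) : ℂ :=
  ρ * (x : ℂ) ^ (s : ℂ) * ((x : ℂ)⁻¹ * gapSeries s x⁻¹)

theorem Ifun_zero_eq {s : ℝ} (hs : 1 < s) {x : ℝ} (hx : 0 < x) :
    Ifun s x 0 = contourPart s x + correction s x := by
  rw [Ifun, integral_eq_contourPart, integral_tsum_eq_gapSeries hs hx, correction]

theorem differentiableAt_correction {s : ℝ} (hs : 1 < s) {x : ℝ} (hx : 0 < x) :
    DifferentiableAt ℝ (correction s) x := by
  have hof : DifferentiableAt ℝ (fun x : ℝ => (x : ℂ)) x := Complex.ofRealCLM.differentiableAt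
  have hx' : (x : ℂ) ≠ 0 := by exact_mod_cast hx.ne'
  have hpow : DifferentiableAt ℝ (fun x : ℝ => (x : ℂ) ^ (s : ℂ)) x :=
    DifferentiableAt.comp (g := fun z : ℂ => z ^ (s : ℂ)) x
      ((differentiableAt_id.cpow_const (c := (s : ℂ))
        (Complex.ofReal_mem_slitPlane.2 hx)).restrictScalars ℝ) hof
  have hG : DifferentiableAt ℝ (fun x : ℝ => gapSeries s x⁻¹) x :=
    (differentiableAt_gapSeries hs (inv_pos.2 hx)).comp x (differentiableAt_inv hx.ne')
  exact (hpow.const_mul ρ).mul ((hof.inv hx').mul hG)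

theorem tendsto_correction {s : ℝ} (hs : 1 < s) : Tendsto (correction s) (𝓝[>] 0) (𝓝 0) := by
  set K : ℝ := ∑' k : ℕ, (((k + 1 : ℕ) : ℝ) ^ s)⁻¹
  refine squeeze_zero_norm' (a := fun x : ℝ => x ^ (s - 1) * (K * ((2 ^ s + 1) * √x))) ?_ ?_
  · filter_upwards [self_mem_nhdsWithin] with x hx
    have hx : 0 < x := hx
    have h := norm_gapSeries_le hs (inv_pos.2 hx)
    rw [inv_inv] at h
    rw [correction, norm_mul, norm_mul, norm_mul, norm_ρ, one_mul, Complex.norm_cpow_real, norm_inv,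
      Complex.norm_real, Real.norm_of_nonneg hx.le, ← mul_assoc, ← div_eq_mul_inv,
      ← Real.rpow_sub_one hx.ne']
    exact mul_le_mul_of_nonneg_left h (by positivity)
  · have hc : Continuous fun x : ℝ => x ^ (s - 1) * (K * ((2 ^ s + 1) * √x)) :=
      (Real.continuous_rpow_const (by linarith)).mul (by fun_prop)
    simpa using (hc.tendsto 0).mono_left nhdsWithin_le_nhds

theorem differentiableAt_Ifun_zero {s : ℝ} (hs : 1 < s) {x : ℝ} (hx : 0 < x) :
    DifferentiableAt ℝ (fun y => Ifun s y 0) x := by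
  refine ((differentiableAt_contourPart (s := s) (by linarith) hx).add
    (differentiableAt_correction hs hx)).congr_of_eventuallyEq ?_
  filter_upwards [lt_mem_nhds hx] with y hy
  exact Ifun_zero_eq hs hy

theorem tendsto_Ifun_zero {s : ℝ} (hs : 1 < s) :
    Tendsto (fun x => Ifun s x 0) (𝓝[>] 0)
      (𝓝 (∫ v, (1 + Complex.I) * kernel s (linePoint 1 v))) := by
  have h := (tendsto_contourPart hs).add (tendsto_correction hs)
  rw [add_zero] at h
  refine h.congr' ?_
  filter_upwards [self_mem_nhdsWithin] with x hx
  exact (Ifun_zero_eq hs hx).symm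

theorem Omega0_of_pos (s : ℝ) {x : ℝ} (hx : 0 < x) : Omega0 s x = Ifun s x 0 := by
  rw [Omega0, Omega, if_pos hx]

theorem Omega0_of_neg (s : ℝ) {x : ℝ} (hx : x < 0) :
    Omega0 s x = (starRingEnd ℂ) (Ifun s (-x) 0) := by
  rw [Omega0, Omega, if_neg hx.not_gt, neg_zero]

/-- for `s > 1`, `Ω_s` is differentiable on `ℝ \ {0}` and has a finite limit
at `0`. -/
theorem stmt9 (s : ℝ) (hs : 1 < s) :
    (∀ x : ℝ, x ≠ 0 → DifferentiableAt ℝ (fun y : ℝ => Omega0 s y) x) ∧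
      ∃ L : ℂ, Tendsto (fun x : ℝ => Omega0 s x) (𝓝[≠] (0 : ℝ)) (𝓝 L) := by
  refine ⟨fun x hx => ?_, ∫ v, (1 + Complex.I) * kernel s (linePoint 1 v), ?_⟩
  · rcases lt_or_gt_of_ne hx with hx | hx
    · have h1 : DifferentiableAt ℝ (fun y : ℝ => Ifun s (-y) 0) x :=
        (differentiableAt_Ifun_zero hs (neg_pos.2 hx)).comp x differentiableAt_id.neg
      have h2 : DifferentiableAt ℝ (fun y : ℝ => (starRingEnd ℂ) (Ifun s (-y) 0)) x :=
        Complex.conjCLE.differentiableAt.comp x h1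
      refine h2.congr_of_eventuallyEq ?_
      filter_upwards [gt_mem_nhds hx] with y hy
      exact Omega0_of_neg s hy
    · refine (differentiableAt_Ifun_zero hs hx).congr_of_eventuallyEq ?_
      filter_upwards [lt_mem_nhds hx] with y hy
      exact Omega0_of_pos s hy
  · rw [← Set.Iio_union_Ioi, nhdsWithin_union, tendsto_sup]
    constructor
    · have h1 : Tendsto (fun x : ℝ => -x) (𝓝[<] 0) (𝓝[>] 0) := by
        simpa using tendsto_neg_nhdsLT (a := (0 : ℝ))
      have h2 := (Complex.continuous_conj.tendsto _).comp ((tendsto_Ifun_zero hs).comp h1)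
      rw [conj_integral_kernel hs] at h2
      refine h2.congr' ?_
      filter_upwards [self_mem_nhdsWithin] with x hx
      exact (Omega0_of_neg s hx).symm
    · refine (tendsto_Ifun_zero hs).congr' ?_
      filter_upwards [self_mem_nhdsWithin] with x hx
      exact (Omega0_of_pos s hx).symm
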